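/- arXiv:0810.2780 — 2 statements merged into one kernel-verified Lean document; each statement's English description precedes it below -/
import Mathlib

section
/- Let n, w, j be natural numbers with 0 ≤ w ≤ n and 0 ≤ j ≤ n. Identify binary strings of length n with pairs (x, z) where x is a binary string of length j and z is a binary string of length n − j (by concatenation). Then for every such pair (x, z), the coordinate of the symmetric state S^n_w at the string (x,z) equals: √( C(n−j, w−H(x)) / C(n,w) ) times the coordinate of S^{n−j}_{w−H(x)} at z, whenever H(x) ≤ w ≤ H(x) + (n − j), and 0 otherwise. Equivalently, S^n_w = Σ_{x ∈ {0,1}^j, H(x) ≤ w ≤ H(x)+(n−j)} √( C(n−j, w−H(x)) / C(n,w) ) · e_x ⊗ S^{n−j}_{w−H(x)}, where e_x is the standard basis vector of ℂ^{{0,1}^j} indexed by x. -/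
/-- Hamming weight of a binary string of length `m`. -/
def hamW {m : ℕ} (y : Fin m → Bool) : ℕ :=
  (Finset.univ.filter fun j => y j = true).card

/-- The symmetric state `S^m_v ∈ ℂ^{{0,1}^m}`: coordinate `1/√(C(m,v))` at
strings of Hamming weight `v`, and `0` elsewhere. -/
noncomputable def symS (m v : ℕ) : (Fin m → Bool) → ℂ := fun y =>
  if hamW y = v then ((Real.sqrt (m.choose v) : ℝ)⁻¹ : ℂ) else 0

theorem hamW_append {j m : ℕ} (x : Fin j → Bool) (z : Fin m → Bool) :
    hamW (Fin.append x z) = hamW x + hamW z := by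
  simp only [hamW, Finset.card_filter, Fin.sum_univ_add, Fin.append_left, Fin.append_right]

theorem hamW_comp_cast {n m : ℕ} (h : n = m) (y : Fin m → Bool) :
    hamW (fun i : Fin n => y (Fin.cast h i)) = hamW y := by
  subst h
  rfl

theorem hamW_le {m : ℕ} (y : Fin m → Bool) : hamW y ≤ m := by
  simpa [hamW] using Finset.card_filter_le Finset.univ fun j => y j = true

/-- decomposition of the symmetric state under splitting a
length-`n` string into a prefix `x` of length `j` and a suffix `z` of length
`n − j`:
`(S^n_w)_{(x,z)} = √( C(n−j, w−H(x)) / C(n,w) ) · (S^{n−j}_{w−H(x)})_z`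
when `H(x) ≤ w ≤ H(x) + (n − j)`, and `0` otherwise. -/
theorem stmt6 (n w j : ℕ) (hw : w ≤ n) (hj : j ≤ n)
    (x : Fin j → Bool) (z : Fin (n - j) → Bool) :
    symS n w (fun i : Fin n => Fin.append x z (Fin.cast (by omega) i))
      = if hamW x ≤ w ∧ w ≤ hamW x + (n - j) then
          (Real.sqrt ((((n - j).choose (w - hamW x) : ℝ)) / ((n.choose w : ℝ))) : ℂ) *
            symS (n - j) (w - hamW x) z
        else 0 := by
  have hz := hamW_le z
  rw [symS, hamW_comp_cast, hamW_append]
  split_ifs with hsum hrange hrange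
  · have hzw : hamW z = w - hamW x := by omega
    have hpos : 0 < (n - j).choose (w - hamW x) := Nat.choose_pos (by omega)
    have hne : ((Real.sqrt ((n - j).choose (w - hamW x)) : ℝ) : ℂ) ≠ 0 :=
      Complex.ofReal_ne_zero.mpr (Real.sqrt_ne_zero'.mpr (Nat.cast_pos.mpr hpos))
    rw [symS, if_pos hzw, Real.sqrt_div (Nat.cast_nonneg _), Complex.ofReal_div, div_mul_eq_mul_div,
      mul_inv_cancel₀ hne, one_div]
  · omega
  · rw [symS, if_neg (by omega), mul_zero]
  · rfl
end

section
/- Let n be a natural number and for θ ∈ ℝ define v(θ) ∈ ℂ^{{0,1}^n} by v(θ)_x = 2^{−n/2} · exp(i·H(x)·θ). Then for all binary strings x, y of length n: (1/2π) ∫_0^{2π} v(θ)_x · conj(v(θ)_y) dθ = Σ_{w=0}^{n} (C(n,w)/2^n) · (S^n_w)_x · conj((S^n_w)_y). That is, the uniform phase-average of the rank-one projections onto v(θ) equals the mixture Σ_{w=0}^n (C(n,w)/2^n) · S^n_w (S^n_w)†; both sides equal 2^{−n} when H(x) = H(y) and 0 otherwise. -/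
/-- The state `v(θ)` with coordinates `2^{−n/2}·exp(i·H(x)·θ)`. -/
noncomputable def vtheta (n : ℕ) (θ : ℝ) : (Fin n → Bool) → ℂ := fun x =>
  (((2 : ℝ) ^ (-(n : ℝ) / 2) : ℝ) : ℂ) * Complex.exp (Complex.I * (hamW x : ℂ) * (θ : ℂ))

theorem integral_exp_int_mul_I (k : ℤ) :
    ∫ θ in (0 : ℝ)..(2 * Real.pi), Complex.exp (Complex.I * (k : ℂ) * (θ : ℂ)) =
      if k = 0 then 2 * (Real.pi : ℂ) else 0 := by
  split_ifs with hk
  · simp [hk]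
  · have hc : Complex.I * (k : ℂ) ≠ 0 := mul_ne_zero Complex.I_ne_zero (by exact_mod_cast hk)
    rw [integral_exp_mul_complex hc]
    have h : Complex.I * (k : ℂ) * ((2 * Real.pi : ℝ) : ℂ) =
        (k : ℂ) * (2 * (Real.pi : ℂ) * Complex.I) := by
      push_cast
      ring
    rw [h, Complex.exp_int_mul_two_pi_mul_I]
    simp

theorem vtheta_mul_conj (n : ℕ) (θ : ℝ) (x y : Fin n → Bool) :
    vtheta n θ x * (starRingEnd ℂ) (vtheta n θ y) =
      (1 / 2 ^ n) *
        Complex.exp (Complex.I * (((hamW x : ℤ) - (hamW y : ℤ) : ℤ) : ℂ) * (θ : ℂ)) := by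
  have h2 : (2 : ℝ) ^ (-(n : ℝ) / 2) * (2 : ℝ) ^ (-(n : ℝ) / 2) = 1 / 2 ^ n := by
    rw [← Real.rpow_add two_pos, add_halves, Real.rpow_neg zero_le_two, Real.rpow_natCast,
      one_div]
  have h2c : (((2 : ℝ) ^ (-(n : ℝ) / 2) : ℝ) : ℂ) * (((2 : ℝ) ^ (-(n : ℝ) / 2) : ℝ) : ℂ) =
      1 / 2 ^ n := by
    rw [← Complex.ofReal_mul, h2]
    push_cast
    rfl
  simp only [vtheta, map_mul, Complex.conj_ofReal, ← Complex.exp_conj, Complex.conj_I,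
    map_natCast]
  rw [mul_mul_mul_comm, h2c, ← Complex.exp_add]
  congr 2
  push_cast
  ring

theorem choose_mul_symS_mul_conj (n w : ℕ) (hw : w ≤ n) (x y : Fin n → Bool) :
    ((n.choose w : ℂ) / 2 ^ n) * symS n w x * (starRingEnd ℂ) (symS n w y) =
      if w = hamW x then (if hamW x = hamW y then 1 / 2 ^ n else 0) else 0 := by
  by_cases hx : hamW x = w
  · subst hx
    by_cases hy : hamW x = hamW y
    · have hc : (n.choose (hamW x) : ℂ) ≠ 0 := by
        exact_mod_cast (Nat.choose_pos hw).ne'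
      have hs : ((Real.sqrt (n.choose (hamW x)) : ℝ) : ℂ) *
          ((Real.sqrt (n.choose (hamW x)) : ℝ) : ℂ) = (n.choose (hamW x) : ℂ) := by
        rw [← Complex.ofReal_mul, Real.mul_self_sqrt (Nat.cast_nonneg _), Complex.ofReal_natCast]
      simp only [symS, if_true, hy.symm, map_inv₀, Complex.conj_ofReal]
      rw [mul_assoc, ← mul_inv, hs, div_mul_eq_mul_div, mul_inv_cancel₀ hc]
    · simp [symS, hy, Ne.symm hy]
  · simp [symS, hx, Ne.symm hx]

/-- the uniform phase-average of the rank-one projections onto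
`v(θ)` equals the mixture `Σ_{w=0}^n (C(n,w)/2^n) · S^n_w (S^n_w)†`,
entrywise. -/
theorem stmt7 (n : ℕ) (x y : Fin n → Bool) :
    (1 / (2 * (Real.pi : ℂ))) *
        ∫ θ in (0 : ℝ)..(2 * Real.pi),
          vtheta n θ x * (starRingEnd ℂ) (vtheta n θ y)
      = ∑ w ∈ Finset.range (n + 1),
          ((n.choose w : ℂ) / 2 ^ n) * symS n w x * (starRingEnd ℂ) (symS n w y) := by
  simp_rw [vtheta_mul_conj]
  rw [intervalIntegral.integral_const_mul, integral_exp_int_mul_I,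
    Finset.sum_congr rfl fun w hw => choose_mul_symS_mul_conj n w
      (Nat.lt_succ_iff.mp (Finset.mem_range.mp hw)) x y,
    Finset.sum_ite_eq', if_pos (Finset.mem_range.mpr (Nat.lt_succ_of_le (hamW_le x)))]
  have hpi : (Real.pi : ℂ) ≠ 0 := by exact_mod_cast Real.pi_ne_zero
  by_cases h : hamW x = hamW y
  · rw [if_pos (by rw [h, sub_self]), if_pos h]
    field_simp
  · rw [if_neg (by rwa [sub_eq_zero, Nat.cast_inj]), if_neg h]
    simp
end
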